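/- arXiv:2105.08339 — 6 statements merged into one kernel-verified Lean document; each statement's English description precedes it below -/
import Mathlib

section
/- For every dimension d ≥ 1, every nonzero x ∈ ℝ^d, and every real d×d orthogonal matrix R, the squared error S ↦ ‖x − Rᵀ(S·sign(Rx))‖₂² is minimized over S ∈ ℝ at S = ‖Rx‖₁/d (i.e., for every S' ∈ ℝ, ‖x − Rᵀ((‖Rx‖₁/d)·sign(Rx))‖₂² ≤ ‖x − Rᵀ(S'·sign(Rx))‖₂²), and at this scale the squared error equals ‖x‖₂²·(1 − ‖R x̆‖₁²/d), where x̆ = x/‖x‖₂. -/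
open Matrix BigOperators

/-- Coordinatewise binary sign: `1` if the coordinate is nonnegative, `-1` otherwise. -/
noncomputable def signVec {d : ℕ} (y : Fin d → ℝ) : Fin d → ℝ :=
  fun i => if 0 ≤ y i then 1 else -1

/-- DRIVE estimate `x̂ = Rᵀ (S • sign (R x))`. -/
noncomputable def driveEst {d : ℕ} (R : Matrix (Fin d) (Fin d) ℝ) (S : ℝ)
    (x : Fin d → ℝ) : Fin d → ℝ :=
  Rᵀ.mulVec (S • signVec (R.mulVec x))

/-- Squared error of the DRIVE estimate with scale `S`. -/
noncomputable def driveSSE {d : ℕ} (R : Matrix (Fin d) (Fin d) ℝ) (S : ℝ)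
    (x : Fin d → ℝ) : ℝ :=
  ∑ i, (x i - driveEst R S x i) ^ 2

theorem mul_signVec {d : ℕ} (y : Fin d → ℝ) (i : Fin d) : y i * signVec y i = |y i| := by
  unfold signVec
  split_ifs with h
  · rw [mul_one, abs_of_nonneg h]
  · rw [mul_neg_one, abs_of_neg (not_le.mp h)]

theorem signVec_mul_self {d : ℕ} (y : Fin d → ℝ) (i : Fin d) :
    signVec y i * signVec y i = 1 := by
  unfold signVec
  split_ifs <;> norm_num

theorem dotProduct_signVec {d : ℕ} (y : Fin d → ℝ) : y ⬝ᵥ signVec y = ∑ i, |y i| := by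
  simp [dotProduct, mul_signVec]

theorem signVec_dotProduct_self {d : ℕ} (y : Fin d → ℝ) :
    signVec y ⬝ᵥ signVec y = d := by
  simp [dotProduct, signVec_mul_self]

/-- For orthogonal `R`, the squared error is a quadratic polynomial in the scale. -/
theorem driveSSE_eq {d : ℕ} {R : Matrix (Fin d) (Fin d) ℝ} (hR : Rᵀ * R = 1) (S : ℝ)
    (x : Fin d → ℝ) :
    driveSSE R S x = ∑ i, (x i) ^ 2 - 2 * S * ∑ i, |R.mulVec x i| + S ^ 2 * d := by
  have inner_transpose (u v : Fin d → ℝ) : u ⬝ᵥ Rᵀ *ᵥ v = R *ᵥ u ⬝ᵥ v := by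
    rw [dotProduct_mulVec, vecMul_transpose]
  have hsse : driveSSE R S x = (x - driveEst R S x) ⬝ᵥ (x - driveEst R S x) := by
    simp [driveSSE, dotProduct, sq]
  have hcross : x ⬝ᵥ driveEst R S x = S * ∑ i, |R.mulVec x i| := by
    rw [driveEst, inner_transpose, dotProduct_smul, dotProduct_signVec, smul_eq_mul]
  have hest : driveEst R S x ⬝ᵥ driveEst R S x = S ^ 2 * d := by
    rw [driveEst, inner_transpose, mulVec_mulVec, mul_eq_one_comm.mp hR, one_mulVec,
      smul_dotProduct, dotProduct_smul, signVec_dotProduct_self, smul_eq_mul, smul_eq_mul]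
    ring
  have hself : x ⬝ᵥ x = ∑ i, (x i) ^ 2 := by simp [dotProduct, sq]
  rw [hsse, sub_dotProduct, dotProduct_sub, dotProduct_sub, dotProduct_comm (driveEst R S x) x,
    hcross, hest, hself]
  ring

theorem sum_abs_mulVec_div {d : ℕ} (R : Matrix (Fin d) (Fin d) ℝ) (x : Fin d → ℝ) {c : ℝ}
    (hc : 0 ≤ c) :
    ∑ i, |R.mulVec (fun j => x j / c) i| = (∑ i, |R.mulVec x i|) / c := by
  have hdiv : (fun j => x j / c) = c⁻¹ • x := by
    ext j
    simp [div_eq_inv_mul]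
  rw [hdiv, mulVec_smul, div_eq_inv_mul, Finset.mul_sum]
  simp [abs_mul, abs_of_nonneg hc]

theorem drive_optimal_scale (d : ℕ) (hd : 1 ≤ d) (x : Fin d → ℝ) (hx : x ≠ 0)
    (R : Matrix (Fin d) (Fin d) ℝ) (hR : Rᵀ * R = 1) :
    (∀ S' : ℝ,
      driveSSE R ((∑ i, |R.mulVec x i|) / d) x ≤ driveSSE R S' x) ∧
    driveSSE R ((∑ i, |R.mulVec x i|) / d) x
      = (∑ i, (x i) ^ 2) *
        (1 - (∑ i, |R.mulVec (fun j => x j / Real.sqrt (∑ i, (x i) ^ 2)) i|) ^ 2 / d) := by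
  have hd' : (0 : ℝ) < d := by exact_mod_cast hd
  refine ⟨fun S' => ?_, ?_⟩
  · rw [driveSSE_eq hR, driveSSE_eq hR, ← sub_nonneg]
    set L := ∑ i, |R.mulVec x i|
    have hsq : 0 ≤ d * (S' - L / d) ^ 2 := by positivity
    convert hsq using 1
    field_simp
    ring
  · have hpos : 0 < ∑ i, (x i) ^ 2 := by
      obtain ⟨i, hi⟩ := Function.ne_iff.mp hx
      exact Finset.sum_pos' (fun j _ => sq_nonneg (x j))
        ⟨i, Finset.mem_univ i, sq_pos_of_ne_zero hi⟩
    rw [driveSSE_eq hR, sum_abs_mulVec_div R x (Real.sqrt_nonneg _),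
      div_pow _ √(∑ i, (x i) ^ 2), Real.sq_sqrt hpos.le]
    field_simp
    ring
end

section
/- For every dimension d ≥ 2, the uniformly distributed point T = Z/‖Z‖₂ on the unit sphere S^{d−1} satisfies E[‖T‖₁²] = 1 + (d−1)·(2/π). Equivalently, the vNMSE of DRIVE with a uniform random rotation and the optimal scale S = ‖R(x)‖₁/d equals 1 − E[‖T‖₁²]/d = (1 − 2/π)·(1 − 1/d) for every nonzero x ∈ ℝ^d. -/
open MeasureTheory BigOperators

/-- The law of a standard Gaussian vector in `ℝ^d`: the product of `d` standard
normal distributions. -/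
noncomputable def stdGaussian (d : ℕ) : Measure (Fin d → ℝ) :=
  Measure.pi fun _ => ProbabilityTheory.gaussianReal 0 1

/-- The Laplace transform of the square of a standard normal variable. -/
lemma integral_exp_neg_mul_sq_gaussianReal {t : ℝ} (ht : 0 ≤ t) :
    ∫ x, Real.exp (-t * x ^ 2) ∂ProbabilityTheory.gaussianReal 0 1 = (√(1 + 2 * t))⁻¹ := by
  have hpos : 0 < 1 + 2 * t := by positivity
  have hpdf : ∀ x : ℝ, ProbabilityTheory.gaussianPDFReal 0 1 x • Real.exp (-t * x ^ 2) =
      (√(2 * Real.pi))⁻¹ * Real.exp (-((1 + 2 * t) / 2) * x ^ 2) := fun x => by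
    simp only [ProbabilityTheory.gaussianPDFReal, smul_eq_mul, mul_assoc, ← Real.exp_add,
      NNReal.coe_one, mul_one, sub_zero]
    ring_nf
  rw [ProbabilityTheory.integral_gaussianReal_eq_integral_smul one_ne_zero]
  simp_rw [hpdf]
  rw [integral_const_mul, integral_gaussian, ← Real.sqrt_inv, ← Real.sqrt_inv,
    ← Real.sqrt_mul (by positivity)]
  congr 1
  field_simp

lemma integral_abs_mul_exp_neg_mul_sq_gaussianReal {t : ℝ} (ht : 0 ≤ t) :
    ∫ x, |x| * Real.exp (-t * x ^ 2) ∂ProbabilityTheory.gaussianReal 0 1 =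
      √(2 / Real.pi) * (√(1 + 2 * t))⁻¹ ^ 2 := by
  have hpos : 0 < 1 + 2 * t := by positivity
  have hpdf : ∀ x : ℝ, ProbabilityTheory.gaussianPDFReal 0 1 x • (|x| * Real.exp (-t * x ^ 2)) =
      (√(2 * Real.pi))⁻¹ * (|x| ^ (1 : ℝ) *
        Real.exp (-((1 + 2 * t) / 2) * |x| ^ (2 : ℝ))) := fun x => by
    have hexp : Real.exp (-((1 + 2 * t) / 2) * x ^ 2) =
        Real.exp (-x ^ 2 / 2) * Real.exp (-t * x ^ 2) := by
      rw [← Real.exp_add]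
      ring_nf
    rw [Real.rpow_one, Real.rpow_two, sq_abs, hexp]
    simp only [ProbabilityTheory.gaussianPDFReal, smul_eq_mul, NNReal.coe_one, mul_one, sub_zero]
    ring
  rw [ProbabilityTheory.integral_gaussianReal_eq_integral_smul one_ne_zero]
  simp_rw [hpdf]
  rw [integral_const_mul, integral_comp_abs
    (f := fun x => x ^ (1 : ℝ) * Real.exp (-((1 + 2 * t) / 2) * x ^ (2 : ℝ))),
    integral_rpow_mul_exp_neg_mul_rpow two_pos (by norm_num) (by positivity), inv_pow,
    Real.sq_sqrt hpos.le, Real.sqrt_div two_pos.le, Real.sqrt_mul two_pos.le]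
  norm_num [Real.rpow_neg_one]
  field_simp
  norm_num

lemma hasDerivAt_inv_sqrt_one_add_two_mul_pow (d : ℕ) {t : ℝ} (ht : 0 ≤ t) :
    HasDerivAt (fun t : ℝ => (√(1 + 2 * t))⁻¹ ^ d) (-(d * (√(1 + 2 * t))⁻¹ ^ (d + 2))) t := by
  have hpos : 0 < 1 + 2 * t := by positivity
  have hlin : HasDerivAt (fun t : ℝ => 1 + 2 * t) 2 t := by
    simpa using ((hasDerivAt_id t).const_mul 2).const_add 1
  refine (((hlin.sqrt hpos.ne').inv (by positivity)).pow d).congr_deriv ?_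
  obtain _ | n := d
  · simp
  · simp only [Nat.add_sub_cancel, Pi.inv_apply, pow_add]
    field_simp

lemma tendsto_inv_sqrt_one_add_two_mul_pow {d : ℕ} (hd : d ≠ 0) :
    Filter.Tendsto (fun t : ℝ => (√(1 + 2 * t))⁻¹ ^ d) Filter.atTop (nhds 0) := by
  have hlin : Filter.Tendsto (fun t : ℝ => 1 + 2 * t) Filter.atTop Filter.atTop :=
    Filter.tendsto_atTop_add_const_left _ _ (Filter.tendsto_id.const_mul_atTop two_pos)
  simpa [hd] using (Real.tendsto_sqrt_atTop.comp hlin).inv_tendsto_atTop.pow d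

lemma integral_Ioi_inv_sqrt_one_add_two_mul_pow {d : ℕ} (hd : d ≠ 0) :
    ∫ t in Set.Ioi (0 : ℝ), (√(1 + 2 * t))⁻¹ ^ (d + 2) = 1 / d := by
  have hd' : (d : ℝ) ≠ 0 := Nat.cast_ne_zero.mpr hd
  have h := integral_Ioi_of_hasDerivAt_of_nonneg' (a := 0)
    (g := fun t : ℝ => -(1 / d : ℝ) * (√(1 + 2 * t))⁻¹ ^ d)
    (g' := fun t : ℝ => (√(1 + 2 * t))⁻¹ ^ (d + 2)) (l := 0)
    (fun t ht => ((hasDerivAt_inv_sqrt_one_add_two_mul_pow d ht).const_mul _).congr_deriv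
      (by field_simp))
    (fun t _ => by positivity)
    (by simpa using (tendsto_inv_sqrt_one_add_two_mul_pow hd).const_mul (-(1 / d : ℝ)))
  simpa using h

lemma prod_ite_mem_pair_mul {ι : Type*} [Fintype ι] [DecidableEq ι] {i j : ι} (hij : i ≠ j)
    (a s : ι → ℝ) :
    ∏ k, (if k ∈ ({i, j} : Finset ι) then a k else 1) * s k = a i * a j * ∏ k, s k := by
  rw [Finset.prod_mul_distrib, Fintype.prod_ite_mem, Finset.prod_pair hij]

lemma integral_abs_mul_abs_mul_exp_neg_mul_sum_sq {d : ℕ} {i j : Fin d} (hij : i ≠ j)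
    {t : ℝ} (ht : 0 ≤ t) :
    ∫ z, |z i| * |z j| * Real.exp (-t * ∑ k, z k ^ 2) ∂stdGaussian d =
      2 / Real.pi * (√(1 + 2 * t))⁻¹ ^ (d + 2) := by
  have hprod : ∀ z : Fin d → ℝ, |z i| * |z j| * Real.exp (-t * ∑ k, z k ^ 2) =
      ∏ k, (if k ∈ ({i, j} : Finset (Fin d)) then |z k| else 1) * Real.exp (-t * z k ^ 2) :=
    fun z => by
      rw [prod_ite_mem_pair_mul hij (fun k => |z k|), ← Real.exp_sum, Finset.mul_sum]
  have hcoord : ∀ k : Fin d,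
      ∫ x, (if k ∈ ({i, j} : Finset (Fin d)) then |x| else 1) * Real.exp (-t * x ^ 2)
        ∂ProbabilityTheory.gaussianReal 0 1 =
      (if k ∈ ({i, j} : Finset (Fin d)) then √(2 / Real.pi) * (√(1 + 2 * t))⁻¹ else 1) *
        (√(1 + 2 * t))⁻¹ := fun k => by
    split_ifs
    · rw [integral_abs_mul_exp_neg_mul_sq_gaussianReal ht]
      ring
    · simp_rw [one_mul]
      exact integral_exp_neg_mul_sq_gaussianReal ht
  simp_rw [hprod, stdGaussian]
  rw [integral_fintype_prod_eq_prod (fun (k : Fin d) (x : ℝ) =>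
    (if k ∈ ({i, j} : Finset (Fin d)) then |x| else 1) * Real.exp (-t * x ^ 2))]
  simp_rw [hcoord]
  rw [prod_ite_mem_pair_mul hij (fun _ => √(2 / Real.pi) * (√(1 + 2 * t))⁻¹), Finset.prod_const,
    Finset.card_univ, Fintype.card_fin]
  have hsq : √(2 / Real.pi) * √(2 / Real.pi) = 2 / Real.pi := Real.mul_self_sqrt (by positivity)
  rw [mul_mul_mul_comm, hsq]
  ring

instance isProbabilityMeasure_stdGaussian (d : ℕ) : IsProbabilityMeasure (stdGaussian d) := by
  unfold stdGaussian
  infer_instance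

/-- An off-diagonal second moment of the absolute coordinates on the sphere, via
`1 / ‖z‖² = ∫ exp (-t ‖z‖²)` over `t > 0`. -/
lemma integral_abs_mul_abs_div_sum_sq {d : ℕ} {i j : Fin d} (hij : i ≠ j) :
    ∫ z, |z i| * |z j| / (∑ k, z k ^ 2) ∂stdGaussian d = 2 / Real.pi * (1 / d) := by
  have hd : d ≠ 0 := (Fin.pos i).ne'
  have hlaplace : ∀ z : Fin d → ℝ, |z i| * |z j| / (∑ k, z k ^ 2) =
      ∫ t in Set.Ioi (0 : ℝ), |z i| * |z j| * Real.exp (-t * ∑ k, z k ^ 2) := fun z => by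
    rcases (Finset.sum_nonneg fun k _ => sq_nonneg (z k)).eq_or_lt' with h | h
    · have hz : z i = 0 := by
        simpa using (Finset.sum_eq_zero_iff_of_nonneg fun k _ => sq_nonneg (z k)).mp h i
          (Finset.mem_univ i)
      simp [hz]
    · have hexp := integral_exp_mul_Ioi (neg_neg_of_pos h) 0
      rw [integral_const_mul]
      simp_rw [neg_mul_comm _ (∑ k, z k ^ 2), mul_comm _ (-∑ k, z k ^ 2)]
      rw [hexp]
      simp [div_eq_mul_inv]
  have hint : Integrable (fun p : (Fin d → ℝ) × ℝ =>
      |p.1 i| * |p.1 j| * Real.exp (-p.2 * ∑ k, p.1 k ^ 2))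
      ((stdGaussian d).prod (volume.restrict (Set.Ioi 0))) := by
    refine (integrable_prod_iff' (by fun_prop)).mpr ⟨?_, ?_⟩
    · filter_upwards [ae_restrict_mem measurableSet_Ioi] with t ht
      have ht : 0 < t := ht
      refine Integrable.of_integral_ne_zero ?_
      rw [integral_abs_mul_abs_mul_exp_neg_mul_sum_sq hij ht.le]
      positivity
    · refine (Integrable.of_integral_ne_zero (f := fun t : ℝ => (√(1 + 2 * t))⁻¹ ^ (d + 2))
        ?_).const_mul (2 / Real.pi) |>.congr ?_
      · rw [integral_Ioi_inv_sqrt_one_add_two_mul_pow hd]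
        positivity
      · filter_upwards [ae_restrict_mem measurableSet_Ioi] with t ht
        rw [← integral_abs_mul_abs_mul_exp_neg_mul_sum_sq hij (le_of_lt ht)]
        simp
  simp_rw [hlaplace]
  rw [integral_integral_swap hint, setIntegral_congr_fun measurableSet_Ioi fun t ht =>
    integral_abs_mul_abs_mul_exp_neg_mul_sum_sq hij (le_of_lt ht), integral_const_mul,
    integral_Ioi_inv_sqrt_one_add_two_mul_pow hd]

lemma integrable_abs_mul_abs_div_sum_sq {d : ℕ} {i j : Fin d} (hij : i ≠ j) :
    Integrable (fun z => |z i| * |z j| / (∑ k, z k ^ 2)) (stdGaussian d) := by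
  have hd : d ≠ 0 := (Fin.pos i).ne'
  refine Integrable.of_integral_ne_zero ?_
  rw [integral_abs_mul_abs_div_sum_sq hij]
  positivity

lemma ae_sum_sq_ne_zero_stdGaussian {d : ℕ} (hd : d ≠ 0) :
    ∀ᵐ z ∂stdGaussian d, ∑ k, z k ^ 2 ≠ 0 := by
  have : Nonempty (Fin d) := Fin.pos_iff_nonempty.mp (Nat.pos_of_ne_zero hd)
  have : NullSingletonClass (ProbabilityTheory.gaussianReal 0 1) :=
    ProbabilityTheory.nullSingletonClass_gaussianReal one_ne_zero
  have hz : ∀ᵐ z ∂stdGaussian d, z ≠ 0 := by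
    unfold stdGaussian
    exact Measure.ae_ne _ 0
  filter_upwards [hz] with z hz h
  refine hz (funext fun k => ?_)
  simpa using (Finset.sum_eq_zero_iff_of_nonneg fun k _ => sq_nonneg (z k)).mp h k
    (Finset.mem_univ k)

lemma integral_l1_sq_div_sum_sq {d : ℕ} (hd : d ≠ 0) :
    ∫ z, (∑ i, |z i|) ^ 2 / (∑ i, (z i) ^ 2) ∂stdGaussian d =
      1 + ((d : ℝ) - 1) * (2 / Real.pi) := by
  have hexpand : (fun z : Fin d → ℝ => (∑ i, |z i|) ^ 2 / (∑ i, (z i) ^ 2)) =ᵐ[stdGaussian d]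
      fun z => 1 + ∑ p ∈ (Finset.univ : Finset (Fin d)).offDiag,
        |z p.1| * |z p.2| / (∑ k, z k ^ 2) := by
    filter_upwards [ae_sum_sq_ne_zero_stdGaussian hd] with z hz
    rw [← Finset.sum_div, ← div_self hz, ← add_div, sq, Finset.sum_mul_sum,
      ← Finset.sum_product', ← Finset.diag_union_offDiag,
      Finset.sum_union (Finset.disjoint_diag_offDiag _), Finset.sum_diag]
    simp [← sq]
  have hne : ∀ p ∈ (Finset.univ : Finset (Fin d)).offDiag, p.1 ≠ p.2 := fun p hp =>
    (Finset.mem_offDiag.mp hp).2.2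
  rw [integral_congr_ae hexpand, integral_add (integrable_const _)
    (integrable_finsetSum _ fun p hp => integrable_abs_mul_abs_div_sum_sq (hne p hp)),
    integral_finsetSum _ fun p hp => integrable_abs_mul_abs_div_sum_sq (hne p hp),
    Finset.sum_congr rfl fun p hp => integral_abs_mul_abs_div_sum_sq (hne p hp)]
  have hd' : (d : ℝ) ≠ 0 := Nat.cast_ne_zero.mpr hd
  rw [Finset.sum_const, Finset.offDiag_card, nsmul_eq_mul, Nat.cast_sub (Nat.le_mul_self _)]
  simp
  field_simp

theorem expectation_l1_sq_of_uniform_sphere (d : ℕ) (hd : 2 ≤ d) :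
    (∫ z, (∑ i, |z i|) ^ 2 / (∑ i, (z i) ^ 2) ∂stdGaussian d)
        = 1 + ((d : ℝ) - 1) * (2 / Real.pi) ∧
    1 - (∫ z, (∑ i, |z i|) ^ 2 / (∑ i, (z i) ^ 2) ∂stdGaussian d) / d
        = (1 - 2 / Real.pi) * (1 - 1 / (d : ℝ)) := by
  have hd0 : d ≠ 0 := by omega
  have hd' : (d : ℝ) ≠ 0 := Nat.cast_ne_zero.mpr hd0
  rw [integral_l1_sq_div_sum_sq hd0]
  refine ⟨rfl, ?_⟩
  field_simp
  ring
end

section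
/- Let Z^{(d)} denote a standard Gaussian vector in ℝ^d for each d ≥ 2. Then lim_{d→∞} E[d·‖Z^{(d)}‖₂²/‖Z^{(d)}‖₁²] = π/2; equivalently, the vNMSE of unbiased DRIVE with a uniform random rotation, E[d·‖Z^{(d)}‖₂²/‖Z^{(d)}‖₁²] − 1, tends to π/2 − 1 ≈ 0.571 as d → ∞. -/
open MeasureTheory BigOperators Real Filter

open ProbabilityTheory hiding stdGaussian

lemma integral_abs_gaussianReal : ∫ x, |x| ∂gaussianReal 0 1 = √(2 / π) := by
  rw [integral_gaussianReal_eq_integral_smul one_ne_zero]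
  have hpdf : ∀ x : ℝ, gaussianPDFReal 0 1 x • |x| =
      (√(2 * π))⁻¹ * (|x| ^ (1 : ℝ) * exp (-(1 / 2) * |x| ^ (2 : ℝ))) := by
    intro x
    simp only [gaussianPDFReal, smul_eq_mul, NNReal.coe_one, rpow_one, rpow_two, sq_abs]
    ring_nf
  simp_rw [hpdf]
  rw [integral_const_mul, integral_comp_abs
    (f := fun x : ℝ => x ^ (1 : ℝ) * exp (-(1 / 2) * x ^ (2 : ℝ))),
    integral_rpow_mul_exp_neg_mul_rpow two_pos (by norm_num) (by norm_num)]
  have hexp : (-((1 : ℝ) + 1) / 2) = -1 := by norm_num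
  rw [hexp, show ((1 : ℝ) + 1) / 2 = 1 by norm_num, Real.Gamma_one, rpow_neg_one,
    sqrt_mul zero_le_two, sqrt_div zero_le_two]
  have h2 : √(2 : ℝ) ≠ 0 := by positivity
  have hπ : √π ≠ 0 := by positivity
  field_simp
  norm_num

lemma integral_sq_gaussianReal : ∫ x, x ^ 2 ∂gaussianReal 0 1 = 1 := by
  have h := variance_id_gaussianReal (μ := 0) (v := 1)
  rw [variance_of_integral_eq_zero aemeasurable_id (by simp)] at h
  simpa using h

lemma memLp_two_abs_gaussianReal : MemLp (fun x : ℝ => |x|) 2 (gaussianReal 0 1) :=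
  (memLp_id_gaussianReal 2).norm

lemma memLp_two_sq_gaussianReal : MemLp (fun x : ℝ => x ^ 2) 2 (gaussianReal 0 1) := by
  rw [memLp_two_iff_integrable_sq (by fun_prop)]
  have h := (memLp_id_gaussianReal (μ := 0) (v := 1) 4).integrable_norm_pow (p := 4) (by norm_num)
  refine h.congr (ae_of_all _ fun x => ?_)
  simp only [id, norm_eq_abs, ← pow_mul]
  norm_num [← abs_pow, Even.pow_nonneg (by decide : Even 4)]

lemma integrable_exp_neg_abs_gaussianReal :
    Integrable (fun x : ℝ => exp (-|x|)) (gaussianReal 0 1) := by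
  refine Integrable.of_bound (by fun_prop) 1 (ae_of_all _ fun x => ?_)
  simp

lemma exists_integral_exp_neg_abs_gaussianReal_eq :
    ∃ t > 0, ∫ x, exp (-|x|) ∂gaussianReal 0 1 = exp (-(2 * t)) := by
  set q := ∫ x, exp (-|x|) ∂gaussianReal 0 1 with hq
  have hpos : 0 < q := integral_exp_pos integrable_exp_neg_abs_gaussianReal
  have hlt : 0 < ∫ x, (1 - exp (-|x|)) ∂gaussianReal 0 1 := by
    rw [integral_pos_iff_support_of_nonneg (f := fun x : ℝ => 1 - exp (-|x|)) (fun x => by simp)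
      ((integrable_const 1).sub integrable_exp_neg_abs_gaussianReal)]
    have hsupp : Function.support (fun x : ℝ => 1 - exp (-|x|)) = {0}ᶜ := by
      ext x
      rw [Function.mem_support, sub_ne_zero, ne_comm]
      simp
    have : NullSingletonClass (gaussianReal 0 1) := nullSingletonClass_gaussianReal one_ne_zero
    rw [hsupp, prob_compl_eq_one_sub (measurableSet_singleton _), measure_singleton]
    simp
  rw [integral_sub (integrable_const 1) integrable_exp_neg_abs_gaussianReal] at hlt
  simp only [integral_const, probReal_univ, smul_eq_mul, mul_one, ← hq] at hlt
  refine ⟨-log q / 2, by linarith [log_neg hpos (by linarith)], ?_⟩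
  rw [show -(2 * (-log q / 2)) = log q by ring, exp_log hpos]

section EmpiricalMean

variable {Ω : Type*} [MeasurableSpace Ω] {μ : Measure Ω} [IsProbabilityMeasure μ] {f : Ω → ℝ}

lemma integrable_sq_empiricalMean_sub (hf : MemLp f 2 μ) (d : ℕ) :
    Integrable (fun z : Fin d → Ω => ((∑ i, f (z i)) / d - ∫ x, f x ∂μ) ^ 2)
      (Measure.pi fun _ => μ) := by
  have hsum : MemLp (fun z : Fin d → Ω => ∑ i, f (z i)) 2 (Measure.pi fun _ => μ) :=
    memLp_finsetSum _ fun i _ => hf.comp_measurePreserving (measurePreserving_eval _ i)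
  have h := (hsum.mul_const (d : ℝ)⁻¹).sub (memLp_const (∫ x, f x ∂μ))
  simpa [div_eq_mul_inv] using h.integrable_sq

lemma integral_sq_empiricalMean_sub (hf : MemLp f 2 μ) {d : ℕ} (hd : 0 < d) :
    ∫ z : Fin d → Ω, ((∑ i, f (z i)) / d - ∫ x, f x ∂μ) ^ 2 ∂(Measure.pi fun _ => μ) =
      Var[f; μ] / d := by
  have hd' : (d : ℝ) ≠ 0 := by positivity
  have hf1 : Integrable f μ := hf.integrable one_le_two
  have hsum : MemLp (fun z : Fin d → Ω => ∑ i, f (z i)) 2 (Measure.pi fun _ => μ) :=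
    memLp_finsetSum _ fun i _ => hf.comp_measurePreserving (measurePreserving_eval _ i)
  have hmean : ∫ z : Fin d → Ω, (∑ i, f (z i)) ∂(Measure.pi fun _ => μ) =
      d * ∫ x, f x ∂μ := by
    rw [integral_finsetSum _ fun i _ => integrable_comp_eval hf1]
    simp_rw [integral_comp_eval (μ := fun _ : Fin d => μ) hf1.aestronglyMeasurable]
    simp
  have hvar := variance_sum_pi (ι := Fin d) (μ := fun _ => μ) (X := fun _ => f) fun _ => hf
  rw [Finset.sum_fn, variance_eq_integral hsum.aestronglyMeasurable.aemeasurable, hmean] at hvar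
  simp only [Finset.sum_const, Finset.card_univ, Fintype.card_fin, nsmul_eq_mul] at hvar
  have hscale : ∀ z : Fin d → Ω, ((∑ i, f (z i)) / d - ∫ x, f x ∂μ) ^ 2 =
      ((d : ℝ) ^ 2)⁻¹ * ((∑ i, f (z i)) - d * ∫ x, f x ∂μ) ^ 2 := by
    intro z
    field_simp
  simp_rw [hscale]
  rw [integral_const_mul, hvar]
  field_simp

end EmpiricalMean

lemma abs_div_sq_sub_inv_sq_le {a b c t : ℝ} (hc : 0 < c) (ht : 0 < t) (hta : t ≤ a) :
    |b / a ^ 2 - 1 / c ^ 2| ≤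
      (1 / t ^ 2 + 1 / (t * c ^ 2) + 1 / (t ^ 2 * c)) * (|b - 1| + |a - c|) := by
  have ha : 0 < a := ht.trans_le hta
  have hsplit : b / a ^ 2 - 1 / c ^ 2 =
      (b - 1) * (1 / a ^ 2) - (a - c) * (1 / (a * c ^ 2) + 1 / (a ^ 2 * c)) := by
    field_simp
    ring
  have hK : 1 / (a * c ^ 2) + 1 / (a ^ 2 * c) ≤ 1 / (t * c ^ 2) + 1 / (t ^ 2 * c) := by gcongr
  have hL : 1 / a ^ 2 ≤ 1 / t ^ 2 := by gcongr
  have hK0 : 0 < 1 / (t * c ^ 2) + 1 / (t ^ 2 * c) := by positivity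
  have hL0 : 0 < 1 / t ^ 2 := by positivity
  calc |b / a ^ 2 - 1 / c ^ 2|
      ≤ |b - 1| * (1 / a ^ 2) + |a - c| * (1 / (a * c ^ 2) + 1 / (a ^ 2 * c)) := by
        rw [hsplit]
        refine (abs_sub _ _).trans_eq ?_
        rw [abs_mul, abs_mul, abs_of_pos (show 0 < 1 / a ^ 2 by positivity),
          abs_of_pos (show 0 < 1 / (a * c ^ 2) + 1 / (a ^ 2 * c) by positivity)]
    _ ≤ |b - 1| * (1 / t ^ 2) + |a - c| * (1 / (t * c ^ 2) + 1 / (t ^ 2 * c)) := by gcongr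
    _ ≤ _ := by nlinarith [abs_nonneg (b - 1), abs_nonneg (a - c)]

lemma abs_le_inv_add_mul_sq {s : ℝ} (hs : 0 < s) (x : ℝ) : |x| ≤ s⁻¹ + s * x ^ 2 := by
  have h : s⁻¹ + s * x ^ 2 - |x| = s⁻¹ * ((s * |x| - 1 / 2) ^ 2 + 3 / 4) := by
    rw [← sq_abs x]
    field_simp
    ring
  have : 0 ≤ s⁻¹ * ((s * |x| - 1 / 2) ^ 2 + 3 / 4) := by positivity
  linarith

lemma sum_sq_div_sq_sum_abs_le_one {ι : Type*} [Fintype ι] (z : ι → ℝ) :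
    (∑ i, z i ^ 2) / (∑ i, |z i|) ^ 2 ≤ 1 := by
  refine div_le_one_of_le₀ ?_ (sq_nonneg _)
  simpa using Finset.sum_sq_le_sq_sum_of_nonneg (s := Finset.univ) fun i _ => abs_nonneg (z i)

lemma abs_driveRatio_sub_le {d : ℕ} (hd : 0 < d) {c t : ℝ} (hc : 0 < c) (ht : 0 < t)
    (z : Fin d → ℝ) :
    |(d : ℝ) * (∑ i, z i ^ 2) / (∑ i, |z i|) ^ 2 - 1 / c ^ 2| ≤
      (1 / t ^ 2 + 1 / (t * c ^ 2) + 1 / (t ^ 2 * c)) *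
        (2 * (√d)⁻¹ + √d * ((∑ i, z i ^ 2) / d - 1) ^ 2 + √d * ((∑ i, |z i|) / d - c) ^ 2) +
      (d + 1 / c ^ 2) * (exp (d * t) * ∏ i, exp (-|z i|)) := by
  have hd' : 0 < (d : ℝ) := by positivity
  have hs : 0 < √(d : ℝ) := by positivity
  rw [← exp_sum, ← exp_add, Finset.sum_neg_distrib]
  rcases le_or_gt t ((∑ i, |z i|) / d) with hta | hta
  · have hmain := abs_div_sq_sub_inv_sq_le (b := (∑ i, z i ^ 2) / d) hc ht hta
    have hpos : 0 < ∑ i, |z i| := by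
      have := (lt_div_iff₀ hd').1 (ht.trans_le hta)
      simpa using this
    have hratio : (d : ℝ) * (∑ i, z i ^ 2) / (∑ i, |z i|) ^ 2 =
        (∑ i, z i ^ 2) / d / ((∑ i, |z i|) / d) ^ 2 := by
      field_simp
    rw [hratio]
    refine hmain.trans ((mul_le_mul_of_nonneg_left ?_ (by positivity)).trans
      (le_add_of_nonneg_right (by positivity)))
    linarith [abs_le_inv_add_mul_sq hs ((∑ i, z i ^ 2) / d - 1),
      abs_le_inv_add_mul_sq hs ((∑ i, |z i|) / d - c)]
  · rw [div_lt_iff₀ hd'] at hta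
    have hexp : 1 ≤ exp (d * t + -∑ i, |z i|) := one_le_exp (by linarith)
    have hle : (d : ℝ) * (∑ i, z i ^ 2) / (∑ i, |z i|) ^ 2 ≤ d := by
      rw [mul_div_assoc]
      exact mul_le_of_le_one_right hd'.le (sum_sq_div_sq_sum_abs_le_one z)
    have h0 : 0 ≤ (d : ℝ) * (∑ i, z i ^ 2) / (∑ i, |z i|) ^ 2 := by positivity
    have hc0 : 0 < 1 / c ^ 2 := by positivity
    have hd1 : |(d : ℝ) * (∑ i, z i ^ 2) / (∑ i, |z i|) ^ 2 - 1 / c ^ 2| ≤ d + 1 / c ^ 2 := by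
      rw [abs_le]
      constructor <;> linarith
    refine hd1.trans ((le_mul_of_one_le_right (by positivity) hexp).trans
      (le_add_of_nonneg_left (by positivity)))

lemma integrable_driveRatio (d : ℕ) :
    Integrable (fun z : Fin d → ℝ => (d : ℝ) * (∑ i, z i ^ 2) / (∑ i, |z i|) ^ 2)
      (stdGaussian d) := by
  have : IsProbabilityMeasure (stdGaussian d) := by unfold stdGaussian; infer_instance
  refine Integrable.of_bound (Measurable.aestronglyMeasurable (by fun_prop)) d
    (ae_of_all _ fun z => ?_)
  rw [norm_of_nonneg (by positivity), mul_div_assoc]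
  exact mul_le_of_le_one_right (by positivity) (sum_sq_div_sq_sum_abs_le_one z)

lemma abs_integral_driveRatio_sub_le {d : ℕ} (hd : 0 < d) {t : ℝ} (ht : 0 < t)
    (hq : ∫ x, exp (-|x|) ∂gaussianReal 0 1 = exp (-(2 * t))) :
    |(∫ z, (d : ℝ) * (∑ i, z i ^ 2) / (∑ i, |z i|) ^ 2 ∂stdGaussian d) - π / 2| ≤
      (1 / t ^ 2 + 1 / (t * √(2 / π) ^ 2) + 1 / (t ^ 2 * √(2 / π))) *
        (2 + Var[fun x : ℝ => x ^ 2; gaussianReal 0 1] + Var[fun x : ℝ => |x|; gaussianReal 0 1]) *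
        (√d)⁻¹ + (d * exp (-t) ^ d + π / 2 * exp (-t) ^ d) := by
  have hprob : IsProbabilityMeasure (stdGaussian d) := by unfold stdGaussian; infer_instance
  have hc : 0 < √(2 / π) := by positivity
  have hc2 : 1 / √(2 / π) ^ 2 = π / 2 := by
    rw [sq_sqrt (by positivity)]
    simp
  have hs : 0 < √(d : ℝ) := by positivity
  have hI1 : Integrable (fun z : Fin d → ℝ => ((∑ i, |z i|) / d - √(2 / π)) ^ 2)
      (stdGaussian d) := by
    simpa only [integral_abs_gaussianReal, stdGaussian] using
      integrable_sq_empiricalMean_sub memLp_two_abs_gaussianReal d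
  have hI2 : Integrable (fun z : Fin d → ℝ => ((∑ i, z i ^ 2) / d - 1) ^ 2) (stdGaussian d) := by
    simpa only [integral_sq_gaussianReal, stdGaussian] using
      integrable_sq_empiricalMean_sub memLp_two_sq_gaussianReal d
  have hE1 : ∫ z : Fin d → ℝ, ((∑ i, |z i|) / d - √(2 / π)) ^ 2 ∂stdGaussian d =
      Var[fun x : ℝ => |x|; gaussianReal 0 1] / d := by
    simpa only [integral_abs_gaussianReal, stdGaussian] using
      integral_sq_empiricalMean_sub memLp_two_abs_gaussianReal hd
  have hE2 : ∫ z : Fin d → ℝ, ((∑ i, z i ^ 2) / d - 1) ^ 2 ∂stdGaussian d =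
      Var[fun x : ℝ => x ^ 2; gaussianReal 0 1] / d := by
    simpa only [integral_sq_gaussianReal, stdGaussian] using
      integral_sq_empiricalMean_sub memLp_two_sq_gaussianReal hd
  have hI3 : Integrable (fun z : Fin d → ℝ => ∏ i, exp (-|z i|)) (stdGaussian d) :=
    Integrable.fintype_prod fun _ => integrable_exp_neg_abs_gaussianReal
  have hE3 : ∫ z : Fin d → ℝ, ∏ i, exp (-|z i|) ∂stdGaussian d = exp (-(2 * t)) ^ d := by
    rw [stdGaussian, integral_fintype_prod_eq_pow (fun x : ℝ => exp (-|x|)), hq, Fintype.card_fin]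
  have hrate : exp (d * t) * exp (-(2 * t)) ^ d = exp (-t) ^ d := by
    rw [← exp_nat_mul, ← exp_nat_mul, ← exp_add]
    ring_nf
  have hsub : (∫ z, (d : ℝ) * (∑ i, z i ^ 2) / (∑ i, |z i|) ^ 2 ∂stdGaussian d) - π / 2 =
      ∫ z, ((d : ℝ) * (∑ i, z i ^ 2) / (∑ i, |z i|) ^ 2 - 1 / √(2 / π) ^ 2) ∂stdGaussian d := by
    rw [integral_sub (integrable_driveRatio d) (integrable_const _), hc2]
    simp
  have hle : ∀ z : Fin d → ℝ,
      ‖(d : ℝ) * (∑ i, z i ^ 2) / (∑ i, |z i|) ^ 2 - 1 / √(2 / π) ^ 2‖ ≤ _ :=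
    abs_driveRatio_sub_le hd hc ht
  have hA2 : Integrable (fun z : Fin d → ℝ =>
      2 * (√d)⁻¹ + √d * ((∑ i, z i ^ 2) / d - 1) ^ 2) (stdGaussian d) :=
    (integrable_const _).add (hI2.const_mul _)
  have hA : Integrable (fun z : Fin d → ℝ => 2 * (√d)⁻¹ + √d * ((∑ i, z i ^ 2) / d - 1) ^ 2 +
      √d * ((∑ i, |z i|) / d - √(2 / π)) ^ 2) (stdGaussian d) :=
    hA2.add (hI1.const_mul _)
  rw [hsub]
  refine (norm_integral_le_of_norm_le ((hA.const_mul _).add ((hI3.const_mul _).const_mul _))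
    (ae_of_all _ hle)).trans_eq ?_
  rw [integral_add' (hA.const_mul _) ((hI3.const_mul _).const_mul _), integral_const_mul,
    integral_add hA2 (hI1.const_mul _), integral_add (integrable_const _) (hI2.const_mul _),
    integral_const_mul, integral_const_mul, integral_const_mul, integral_const_mul,
    integral_const_mul, hE1, hE2, hE3, hrate, hc2]
  have hdiv : ∀ v : ℝ, √d * (v / d) = v * (√d)⁻¹ := by
    intro v
    have := sq_sqrt (Nat.cast_nonneg (α := ℝ) d)
    field_simp
    rw [this, mul_comm]
  simp only [integral_const, probReal_univ, smul_eq_mul, hdiv]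
  ring

theorem unbiased_drive_vNMSE_limit :
    Tendsto (fun d : ℕ => ∫ z, (d : ℝ) * (∑ i, (z i) ^ 2) / (∑ i, |z i|) ^ 2 ∂stdGaussian d)
      atTop (nhds (π / 2)) ∧
    Tendsto
      (fun d : ℕ => (∫ z, (d : ℝ) * (∑ i, (z i) ^ 2) / (∑ i, |z i|) ^ 2 ∂stdGaussian d) - 1)
      atTop (nhds (π / 2 - 1)) := by
  suffices h : Tendsto
      (fun d : ℕ => ∫ z, (d : ℝ) * (∑ i, (z i) ^ 2) / (∑ i, |z i|) ^ 2 ∂stdGaussian d)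
      atTop (nhds (π / 2)) from ⟨h, h.sub_const 1⟩
  obtain ⟨t, ht, hq⟩ := exists_integral_exp_neg_abs_gaussianReal_eq
  have hr : exp (-t) < 1 := exp_lt_one_iff.mpr (by linarith)
  have hsqrt : Tendsto (fun d : ℕ => (√(d : ℝ))⁻¹) atTop (nhds 0) :=
    tendsto_inv_atTop_zero.comp (tendsto_sqrt_atTop.comp tendsto_natCast_atTop_atTop)
  have hbound := (hsqrt.const_mul
    ((1 / t ^ 2 + 1 / (t * √(2 / π) ^ 2) + 1 / (t ^ 2 * √(2 / π))) *
      (2 + Var[fun x : ℝ => x ^ 2; gaussianReal 0 1] +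
        Var[fun x : ℝ => |x|; gaussianReal 0 1]))).add
    ((tendsto_self_mul_const_pow_of_lt_one (exp_pos _).le hr).add
      ((tendsto_pow_atTop_nhds_zero_of_lt_one (exp_pos _).le hr).const_mul (π / 2)))
  simp only [mul_zero, add_zero] at hbound
  rw [tendsto_iff_dist_tendsto_zero]
  refine squeeze_zero' (Eventually.of_forall fun _ => dist_nonneg) ?_ hbound
  filter_upwards [eventually_gt_atTop 0] with d hd
  exact abs_integral_driveRatio_sub_le hd ht hq
end

section
/- Fix d ≥ 2, let H be any d×d Hadamard matrix (entries in {−1,+1} with H·Hᵀ = d·I), and let D be a random diagonal matrix with i.i.d. Rademacher diagonal entries. Then for every x ∈ ℝ^d, the randomized Hadamard transform R_H x = (1/√d)·H·D·x satisfies E[‖R_H x‖₁²] ≥ (d/2)·‖x‖₂². Consequently, for nonzero x, the vNMSE of DRIVE with the structured random rotation and scale S = ‖R_H x‖₁/d satisfies 1 − (1/d)·E[‖R_H x̆‖₁²] ≤ 1/2, where x̆ = x/‖x‖₂. -/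
open Matrix MeasureTheory BigOperators
open scoped ENNReal

/-- The Rademacher distribution on `ℝ`: `±1` each with probability `1/2`. -/
noncomputable def radMeasure : Measure ℝ :=
  (2 : ℝ≥0∞)⁻¹ • Measure.dirac 1 + (2 : ℝ≥0∞)⁻¹ • Measure.dirac (-1)

/-- The law of `d` i.i.d. Rademacher random variables. -/
noncomputable def radPi (d : ℕ) : Measure (Fin d → ℝ) :=
  Measure.pi fun _ => radMeasure

/-- The randomized Hadamard transform `R_H x = (1/√d) H D x` where `D = diag ε`. -/
noncomputable def rhT {d : ℕ} (H : Matrix (Fin d) (Fin d) ℝ) (ε x : Fin d → ℝ) :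
    Fin d → ℝ :=
  fun i => (1 / Real.sqrt d) * ∑ j, H i j * ε j * x j

/-- The real sign attached to a Boolean. -/
noncomputable def boolSign (b : Bool) : ℝ := if b then 1 else -1

/-- The average of a function over the discrete cube. -/
noncomputable def cubeAvg {n : ℕ} (f : (Fin n → Bool) → ℝ) : ℝ := (∑ e, f e) / 2 ^ n

/-- Flip the `i`-th coordinate of a point of the cube. -/
def cubeFlip {n : ℕ} (i : Fin n) (e : Fin n → Bool) : Fin n → Bool :=
  Function.update e i (!e i)

/-- The antipode of a point of the cube. -/
def cubeNeg {n : ℕ} (e : Fin n → Bool) : Fin n → Bool := fun i => !e i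

/-- The Dirichlet energy of a function on the cube. -/
noncomputable def cubeEnergy {n : ℕ} (f : (Fin n → Bool) → ℝ) : ℝ :=
  ∑ i, cubeAvg fun e => ((f e - f (cubeFlip i e)) / 2) ^ 2

section cubeAvg

variable {n : ℕ} (f g : (Fin n → Bool) → ℝ)

theorem cubeAvg_add : cubeAvg (fun e => f e + g e) = cubeAvg f + cubeAvg g := by
  simp [cubeAvg, Finset.sum_add_distrib, add_div]

theorem cubeAvg_sub : cubeAvg (fun e => f e - g e) = cubeAvg f - cubeAvg g := by
  simp [cubeAvg, Finset.sum_sub_distrib, sub_div]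

theorem cubeAvg_div (c : ℝ) : cubeAvg (fun e => f e / c) = cubeAvg f / c := by
  simp [cubeAvg, ← Finset.sum_div, div_right_comm]

theorem cubeAvg_sum {ι : Type*} (s : Finset ι) (F : ι → (Fin n → Bool) → ℝ) :
    cubeAvg (fun e => ∑ i ∈ s, F i e) = ∑ i ∈ s, cubeAvg (F i) := by
  simp only [cubeAvg, ← Finset.sum_div]
  rw [Finset.sum_comm]

variable {f g} in
theorem cubeAvg_mono (h : ∀ e, f e ≤ g e) : cubeAvg f ≤ cubeAvg g := by
  unfold cubeAvg
  gcongr with e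
  exact h e

theorem cubeAvg_comp_of_involutive {T : (Fin n → Bool) → Fin n → Bool}
    (hT : Function.Involutive T) : cubeAvg (fun e => f (T e)) = cubeAvg f := by
  unfold cubeAvg
  rw [Fintype.sum_equiv hT.toPerm (fun e => f (T e)) f fun _ => rfl]

theorem sq_cubeAvg_le : cubeAvg f ^ 2 ≤ cubeAvg fun e => f e ^ 2 := by
  unfold cubeAvg
  have h := sq_sum_le_card_mul_sum_sq (s := Finset.univ) (f := f)
  simp only [Finset.card_univ, Fintype.card_pi, Fintype.card_bool, Finset.prod_const,
    Fintype.card_fin, Nat.cast_pow, Nat.cast_ofNat] at h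
  rw [div_pow, div_le_div_iff₀ (by positivity) (by positivity)]
  nlinarith [pow_pos (two_pos : (0 : ℝ) < 2) n]

theorem cubeAvg_succ (f : (Fin (n + 1) → Bool) → ℝ) :
    cubeAvg f =
      cubeAvg fun e => (f (Fin.cons true e) + f (Fin.cons false e)) / 2 := by
  unfold cubeAvg
  rw [← (Fin.consEquiv fun _ => Bool).sum_comp, Fintype.sum_prod_type, Fintype.sum_bool,
    ← Finset.sum_div, Finset.sum_add_distrib, pow_succ]
  simp only [Fin.consEquiv, Equiv.coe_fn_mk]
  field_simp

end cubeAvg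

theorem cubeFlip_involutive {n : ℕ} (i : Fin n) : Function.Involutive (cubeFlip i) := by
  intro e
  simp [cubeFlip]

theorem cubeNeg_involutive {n : ℕ} : Function.Involutive (cubeNeg (n := n)) := by
  intro e
  funext i
  simp [cubeNeg]

theorem cubeFlip_zero_cons {n : ℕ} (b : Bool) (e : Fin n → Bool) :
    cubeFlip 0 (Fin.cons b e : Fin (n + 1) → Bool) = Fin.cons (!b) e := by
  simp [cubeFlip]

theorem cubeFlip_succ_cons {n : ℕ} (i : Fin n) (b : Bool) (e : Fin n → Bool) :
    cubeFlip i.succ (Fin.cons b e : Fin (n + 1) → Bool) = Fin.cons b (cubeFlip i e) := by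
  simp [cubeFlip, Fin.cons_update]

theorem cubeNeg_cons {n : ℕ} (b : Bool) (e : Fin n → Bool) :
    cubeNeg (Fin.cons b e : Fin (n + 1) → Bool) = Fin.cons (!b) (cubeNeg e) := by
  funext i
  refine Fin.cases ?_ (fun j => ?_) i <;> simp [cubeNeg]

/-- The energy splits along the even and odd parts in the first coordinate. -/
theorem cubeEnergy_succ {n : ℕ} (f : (Fin (n + 1) → Bool) → ℝ) :
    cubeEnergy f =
      cubeEnergy (fun e => (f (Fin.cons true e) + f (Fin.cons false e)) / 2) +
      cubeEnergy (fun e => (f (Fin.cons true e) - f (Fin.cons false e)) / 2) +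
      cubeAvg fun e => ((f (Fin.cons true e) - f (Fin.cons false e)) / 2) ^ 2 := by
  unfold cubeEnergy
  rw [Fin.sum_univ_succ, add_comm, ← Finset.sum_add_distrib]
  congr 1
  · refine Finset.sum_congr rfl fun i _ => ?_
    rw [cubeAvg_succ, ← cubeAvg_add]
    congr 1
    funext e
    simp only [cubeFlip_succ_cons]
    ring
  · rw [cubeAvg_succ]
    congr 1
    funext e
    simp only [cubeFlip_zero_cons, Bool.not_true, Bool.not_false]
    ring

theorem cubeAvg_sq_succ {n : ℕ} (f : (Fin (n + 1) → Bool) → ℝ) :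
    cubeAvg (fun e => f e ^ 2) =
      cubeAvg (fun e => ((f (Fin.cons true e) + f (Fin.cons false e)) / 2) ^ 2) +
      cubeAvg fun e => ((f (Fin.cons true e) - f (Fin.cons false e)) / 2) ^ 2 := by
  rw [cubeAvg_succ, ← cubeAvg_add]
  congr 1
  funext e
  ring

theorem cubeEnergy_nonneg {n : ℕ} (f : (Fin n → Bool) → ℝ) : 0 ≤ cubeEnergy f :=
  Finset.sum_nonneg fun _ _ =>
    div_nonneg (Finset.sum_nonneg fun _ _ => sq_nonneg _) (by positivity)

/-- The Poincaré inequality on the discrete cube. -/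
theorem cube_poincare {n : ℕ} (f : (Fin n → Bool) → ℝ) :
    cubeAvg (fun e => f e ^ 2) - cubeAvg f ^ 2 ≤ cubeEnergy f := by
  induction n with
  | zero => simp [cubeAvg, cubeEnergy]
  | succ n ih =>
    rw [cubeAvg_sq_succ, cubeEnergy_succ, cubeAvg_succ f]
    have h := ih fun e => (f (Fin.cons true e) + f (Fin.cons false e)) / 2
    have h' := cubeEnergy_nonneg fun e : Fin n → Bool =>
      (f (Fin.cons true e) - f (Fin.cons false e)) / 2
    linarith

theorem sq_cubeAvg_le_even {n : ℕ} (f : (Fin n → Bool) → ℝ) :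
    cubeAvg f ^ 2 ≤ cubeAvg fun e => ((f e + f (cubeNeg e)) / 2) ^ 2 := by
  refine le_trans (le_of_eq ?_) (sq_cubeAvg_le _)
  rw [cubeAvg_div, cubeAvg_add, cubeAvg_comp_of_involutive f cubeNeg_involutive]
  ring

/-- A strengthened Poincaré inequality, with constant `2` up to the odd part of `f`. -/
theorem cube_poincare_even {n : ℕ} (f : (Fin n → Bool) → ℝ) :
    2 * (cubeAvg (fun e => f e ^ 2) - cubeAvg f ^ 2) ≤
      cubeEnergy f + cubeAvg fun e => ((f e - f (cubeNeg e)) / 2) ^ 2 := by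
  induction n with
  | zero =>
    have h : ∀ e : Fin 0 → Bool, cubeNeg e = e := fun e => Subsingleton.elim _ _
    simp [cubeAvg, cubeEnergy, h]
  | succ n ih =>
    have hodd : cubeAvg (fun e => ((f e - f (cubeNeg e)) / 2) ^ 2) =
        cubeAvg (fun e => (((f (Fin.cons true e) + f (Fin.cons false e)) / 2 -
          (f (Fin.cons true (cubeNeg e)) + f (Fin.cons false (cubeNeg e))) / 2) / 2) ^ 2) +
        cubeAvg fun e => (((f (Fin.cons true e) - f (Fin.cons false e)) / 2 +
          (f (Fin.cons true (cubeNeg e)) - f (Fin.cons false (cubeNeg e))) / 2) / 2) ^ 2 := by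
      rw [cubeAvg_succ, ← cubeAvg_add]
      congr 1
      funext e
      simp only [cubeNeg_cons, Bool.not_true, Bool.not_false]
      ring
    rw [cubeAvg_sq_succ, cubeEnergy_succ, cubeAvg_succ f, hodd]
    have h := ih fun e => (f (Fin.cons true e) + f (Fin.cons false e)) / 2
    have h₁ := cube_poincare fun e : Fin n → Bool =>
      (f (Fin.cons true e) - f (Fin.cons false e)) / 2
    have h₂ := sq_cubeAvg_le_even fun e : Fin n → Bool =>
      (f (Fin.cons true e) - f (Fin.cons false e)) / 2
    linarith

theorem cubeAvg_sq_add_sum {n : ℕ} (c : ℝ) (a : Fin n → ℝ) :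
    cubeAvg (fun e => (c + ∑ i, a i * boolSign (e i)) ^ 2) = c ^ 2 + ∑ i, a i ^ 2 := by
  induction n generalizing c with
  | zero => simp [cubeAvg]
  | succ n ih =>
    rw [cubeAvg_succ, cubeAvg_div, cubeAvg_add]
    simp only [Fin.sum_univ_succ, Fin.cons_zero, Fin.cons_succ, ← add_assoc]
    rw [ih _ fun i => a i.succ, ih _ fun i => a i.succ]
    simp only [boolSign]
    norm_num
    ring

theorem boolSign_not (b : Bool) : boolSign (!b) = -boolSign b := by
  cases b <;> simp [boolSign]

theorem sum_boolSign_cubeNeg {n : ℕ} (a : Fin n → ℝ) (e : Fin n → Bool) :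
    ∑ i, a i * boolSign (cubeNeg e i) = -∑ i, a i * boolSign (e i) := by
  simp [cubeNeg, boolSign_not]

theorem sum_boolSign_cubeFlip {n : ℕ} (a : Fin n → ℝ) (i : Fin n) (e : Fin n → Bool) :
    ∑ j, a j * boolSign (cubeFlip i e j) =
      ∑ j, a j * boolSign (e j) - 2 * (a i * boolSign (e i)) := by
  rw [eq_sub_iff_add_eq, ← eq_sub_iff_add_eq', ← Finset.sum_sub_distrib,
    Finset.sum_eq_single i]
  · simp [cubeFlip, boolSign_not]
    ring
  · intro j _ hj
    simp [cubeFlip, hj]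
  · simp

/-- The number operator applied to the absolute value of a Rademacher sum is at most
that absolute value. -/
theorem sum_abs_sub_abs_flip_le {n : ℕ} (a : Fin n → ℝ) (e : Fin n → Bool) :
    ∑ i, (|∑ j, a j * boolSign (e j)| - |∑ j, a j * boolSign (cubeFlip i e j)|) ≤
      2 * |∑ j, a j * boolSign (e j)| := by
  set S := ∑ j, a j * boolSign (e j) with hS
  have h : ∀ i, |S| - |∑ j, a j * boolSign (cubeFlip i e j)| ≤
      SignType.sign S * (2 * (a i * boolSign (e i))) := by
    intro i
    rw [sum_boolSign_cubeFlip, ← hS]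
    generalize 2 * (a i * boolSign (e i)) = t
    rcases lt_trichotomy S 0 with h | h | h
    · rw [abs_of_neg h, sign_neg h]
      have := neg_abs_le (S - t)
      simp only [SignType.coe_neg_one]
      linarith
    · simp [h]
    · rw [abs_of_pos h, sign_pos h]
      have := le_abs_self (S - t)
      simp only [SignType.coe_one]
      linarith
  refine (Finset.sum_le_sum fun i _ => h i).trans (le_of_eq ?_)
  rw [← Finset.mul_sum, ← Finset.mul_sum, ← hS, ← sign_mul_self S]
  ring

theorem cubeEnergy_eq {n : ℕ} (f : (Fin n → Bool) → ℝ) :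
    cubeEnergy f = cubeAvg fun e => f e * (∑ i, (f e - f (cubeFlip i e))) / 2 := by
  simp only [Finset.mul_sum, Finset.sum_div]
  rw [cubeAvg_sum]
  refine Finset.sum_congr rfl fun i _ => ?_
  have h := cubeAvg_comp_of_involutive (fun e => f e ^ 2) (cubeFlip_involutive i)
  have h' : cubeAvg (fun e => ((f e - f (cubeFlip i e)) / 2) ^ 2) -
      cubeAvg (fun e => f e * (f e - f (cubeFlip i e)) / 2) =
      (cubeAvg (fun e => f (cubeFlip i e) ^ 2) - cubeAvg fun e => f e ^ 2) / 4 := by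
    rw [← cubeAvg_sub, ← cubeAvg_sub, ← cubeAvg_div]
    congr 1
    funext e
    ring
  rw [h, sub_self, zero_div] at h'
  linarith

/-- The Khintchine inequality between `L¹` and `L²` with the optimal constant. -/
theorem khintchine_one_two {n : ℕ} (a : Fin n → ℝ) :
    ∑ i, a i ^ 2 ≤ 2 * cubeAvg (fun e => |∑ i, a i * boolSign (e i)|) ^ 2 := by
  have h₂ := cubeAvg_sq_add_sum 0 a
  have h := cube_poincare_even fun e => |∑ i, a i * boolSign (e i)|
  have hE : cubeEnergy (fun e => |∑ i, a i * boolSign (e i)|) ≤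
      cubeAvg fun e => (∑ i, a i * boolSign (e i)) ^ 2 := by
    rw [cubeEnergy_eq]
    refine cubeAvg_mono fun e => ?_
    have := mul_le_mul_of_nonneg_left (sum_abs_sub_abs_flip_le a e)
      (abs_nonneg (∑ j, a j * boolSign (e j)))
    rw [← sq_abs (∑ j, a j * boolSign (e j))]
    linarith
  have h0 : cubeAvg (n := n) (fun _ => 0) = 0 := by simp [cubeAvg]
  simp only [sum_boolSign_cubeNeg, abs_neg, sub_self, zero_div, sq_abs, zero_add, ne_eq,
    OfNat.ofNat_ne_zero, not_false_eq_true, zero_pow, h0] at h h₂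
  linarith

theorem radPi_eq_sum_dirac (d : ℕ) :
    radPi d = ((2 : ℝ≥0∞)⁻¹ ^ d) •
      ∑ e : Fin d → Bool, Measure.dirac fun i => boolSign (e i) := by
  have hfin : IsFiniteMeasure radMeasure := ⟨by simp [radMeasure]⟩
  refine Measure.pi_eq fun s hs => ?_
  have hrad : ∀ i, radMeasure (s i) =
      2⁻¹ * ∑ b : Bool, (s i).indicator 1 (boolSign b) := by
    intro i
    simp [radMeasure, boolSign, Measure.dirac_apply' _ (hs i), mul_add]
  simp only [hrad, Finset.prod_mul_distrib, Finset.prod_const, Finset.card_univ,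
    Fintype.card_fin, Measure.smul_apply, Measure.finsetSum_apply, smul_eq_mul]
  rw [Finset.prod_univ_sum, Fintype.piFinset_univ]
  congr 1
  refine Finset.sum_congr rfl fun e _ => ?_
  rw [Measure.dirac_apply' _ (MeasurableSet.univ_pi hs)]
  by_cases h : ∀ i, boolSign (e i) ∈ s i
  · simp [h]
  · have h' := h
    push Not at h
    obtain ⟨i, hi⟩ := h
    rw [Finset.prod_eq_zero (Finset.mem_univ i) (by simp [hi])]
    simp [h']

theorem integral_radPi {d : ℕ} (g : (Fin d → ℝ) → ℝ) :
    ∫ ε, g ε ∂radPi d = cubeAvg fun e => g fun i => boolSign (e i) := by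
  rw [radPi_eq_sum_dirac, integral_smul_measure, integral_finsetSum_measure]
  · simp [cubeAvg, div_eq_inv_mul]
  · intro e _
    exact integrable_dirac (by simp)

theorem integral_sq_sum_abs_rhT_ge {d : ℕ} (hd : 0 < d) (H : Matrix (Fin d) (Fin d) ℝ)
    (hent : ∀ i j, H i j = 1 ∨ H i j = -1) (x : Fin d → ℝ) :
    ((d : ℝ) / 2) * ∑ i, (x i) ^ 2 ≤ ∫ ε, (∑ i, |rhT H ε x i|) ^ 2 ∂radPi d := by
  have hd' : (0 : ℝ) < d := by exact_mod_cast hd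
  rw [integral_radPi]
  refine le_trans ?_ (sq_cubeAvg_le _)
  rw [cubeAvg_sum]
  have hrow : ∀ i, √((∑ j, x j ^ 2) / (2 * d)) ≤
      cubeAvg fun e => |rhT H (fun j => boolSign (e j)) x i| := by
    intro i
    have hk := khintchine_one_two fun j => 1 / √(d : ℝ) * (H i j * x j)
    have hsq : ∀ j, (1 / √(d : ℝ) * (H i j * x j)) ^ 2 = x j ^ 2 / d := by
      intro j
      rw [mul_pow, div_pow, Real.sq_sqrt hd'.le, mul_pow]
      rcases hent i j with h | h <;> rw [h] <;> ring
    have hfun : ∀ e : Fin d → Bool, ∑ j, 1 / √(d : ℝ) * (H i j * x j) * boolSign (e j) =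
        rhT H (fun j => boolSign (e j)) x i := by
      intro e
      rw [rhT, Finset.mul_sum]
      exact Finset.sum_congr rfl fun j _ => by ring
    simp only [hsq, hfun, ← Finset.sum_div] at hk
    refine Real.sqrt_le_iff.2
      ⟨div_nonneg (Finset.sum_nonneg fun _ _ => abs_nonneg _) (by positivity), ?_⟩
    rw [mul_comm, ← div_div]
    linarith
  have hsum := Finset.sum_le_sum fun i (_ : i ∈ Finset.univ) => hrow i
  rw [Finset.sum_const, Finset.card_univ, Fintype.card_fin, nsmul_eq_mul] at hsum
  refine le_trans (le_of_eq ?_) (pow_le_pow_left₀ (by positivity) hsum 2)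
  rw [mul_pow, Real.sq_sqrt (by positivity)]
  field_simp

theorem hadamard_drive_vNMSE (d : ℕ) (hd : 2 ≤ d) (H : Matrix (Fin d) (Fin d) ℝ)
    (hent : ∀ i j, H i j = 1 ∨ H i j = -1)
    (hHHt : H * Hᵀ = (d : ℝ) • 1) :
    (∀ x : Fin d → ℝ,
      ((d : ℝ) / 2) * ∑ i, (x i) ^ 2 ≤ ∫ ε, (∑ i, |rhT H ε x i|) ^ 2 ∂radPi d) ∧
    (∀ x : Fin d → ℝ, x ≠ 0 →
      1 - (1 / (d : ℝ)) *
          (∫ ε, (∑ i, |rhT H ε (fun j => x j / Real.sqrt (∑ i, (x i) ^ 2)) i|) ^ 2 ∂radPi d)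
        ≤ 1 / 2) := by
  have hd0 : 0 < d := by omega
  have hd' : (0 : ℝ) < d := by exact_mod_cast hd0
  refine ⟨integral_sq_sum_abs_rhT_ge hd0 H hent, fun x hx => ?_⟩
  have hpos : 0 < ∑ i, x i ^ 2 := by
    obtain ⟨i, hi⟩ := Function.ne_iff.1 hx
    exact Finset.sum_pos' (fun _ _ => sq_nonneg _) ⟨i, Finset.mem_univ i, sq_pos_of_ne_zero hi⟩
  have h := integral_sq_sum_abs_rhT_ge hd0 H hent fun j => x j / √(∑ i, x i ^ 2)
  simp only [div_pow, Real.sq_sqrt hpos.le, ← Finset.sum_div] at h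
  rw [div_self hpos.ne', mul_one] at h
  have h' := mul_le_mul_of_nonneg_left h (one_div_nonneg.2 hd'.le)
  have h1 : 1 / (d : ℝ) * (d / 2) = 1 / 2 := by field_simp
  linarith
end

section
/- Fix k ≥ 1, d = 2^k, let H be the Walsh–Hadamard matrix of order d, and let D be any diagonal d×d matrix with diagonal entries in {−1,+1}. Then for the unit vector x = (1/√2, 1/√2, 0, …, 0) ∈ ℝ^d, the rotated vector y = (1/√d)·H·D·x satisfies ‖y‖₁²/d = 1/2 deterministically. (This shows the bound E[‖R_H x‖₁²] ≥ (d/2)‖x‖₂² for the randomized Hadamard transform is sharp.) -/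
open BigOperators

/-- Number of ones in the binary representation of `n`. -/
def popCount (n : ℕ) : ℕ := (Nat.bits n).count true

/-- The Walsh–Hadamard matrix of order `2^k`, with 0-based indices:
`H i j = (-1) ^ popcount(i AND j)`. -/
noncomputable def walsh (d : ℕ) : Matrix (Fin d) (Fin d) ℝ :=
  fun i j => (-1 : ℝ) ^ popCount (i.val &&& j.val)

theorem popCount_and_one (n : ℕ) : popCount (n &&& 1) = n % 2 := by
  rw [Nat.and_one_is_mod]
  rcases Nat.mod_two_eq_zero_or_one n with h | h <;> simp [h, popCount]

theorem walsh_apply_zero {d : ℕ} (i j : Fin d) (hj : j.val = 0) : walsh d i j = 1 := by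
  simp [walsh, hj, popCount]

theorem walsh_apply_one {d : ℕ} (i j : Fin d) (hj : j.val = 1) :
    walsh d i j = (-1) ^ i.val := by
  rw [walsh, hj, popCount_and_one]
  exact (neg_one_pow_eq_pow_mod_two _).symm

theorem sum_fin_mul_ite_lt_two (n : ℕ) (f : Fin (n + 2) → ℝ) (c : ℝ) :
    ∑ j, f j * (if (j : ℕ) < 2 then c else 0) = (f 0 + f 1) * c := by
  rw [Fin.sum_univ_succ, Fin.sum_univ_succ]
  simp [add_mul]

theorem abs_add_neg_one_pow_mul {a b : ℝ} (ha : a = 1 ∨ a = -1) (hb : b = 1 ∨ b = -1) (n : ℕ) :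
    |a + (-1) ^ n * b| = 1 + (-1) ^ n * (a * b) := by
  rcases neg_one_pow_eq_or ℝ n with h | h <;> rcases ha with rfl | rfl <;>
    rcases hb with rfl | rfl <;> rw [h] <;> norm_num

theorem sum_abs_walsh_mul {d : ℕ} (hd : Even d) (hd2 : 2 ≤ d) (D : Fin d → ℝ)
    (hD : ∀ j, D j = 1 ∨ D j = -1) {c : ℝ} (hc : 0 ≤ c) :
    ∑ i, |∑ j, walsh d i j * D j * (if (j : ℕ) < 2 then c else 0)| = d * c := by
  obtain ⟨n, rfl⟩ := Nat.exists_eq_add_of_le' hd2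
  have habs (i : Fin (n + 2)) :
      |∑ j, walsh (n + 2) i j * D j * (if (j : ℕ) < 2 then c else 0)| =
        (1 + (-1) ^ (i : ℕ) * (D 0 * D 1)) * c := by
    rw [sum_fin_mul_ite_lt_two n (fun j => walsh (n + 2) i j * D j), abs_mul, abs_of_nonneg hc,
      walsh_apply_zero i 0 rfl, walsh_apply_one i 1 rfl, one_mul,
      abs_add_neg_one_pow_mul (hD 0) (hD 1)]
  have hsum : ∑ i : Fin (n + 2), (-1 : ℝ) ^ (i : ℕ) = 0 := by
    rw [Fin.sum_univ_eq_sum_range (fun i => (-1 : ℝ) ^ i), neg_one_geom_sum, if_pos hd]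
  simp_rw [habs]
  rw [← Finset.sum_mul, Finset.sum_add_distrib, ← Finset.sum_mul, hsum]
  simp

theorem walsh_sharp_example (k : ℕ) (hk : 1 ≤ k) (D : Fin (2 ^ k) → ℝ)
    (hD : ∀ j, D j = 1 ∨ D j = -1) :
    (∑ i, |(1 / Real.sqrt (2 ^ k)) *
        ∑ j, walsh (2 ^ k) i j * D j *
          (if (j : ℕ) < 2 then (1 / Real.sqrt 2) else 0)|) ^ 2 / (2 ^ k : ℝ)
      = 1 / 2 := by
  have heven : Even (2 ^ k) := (Nat.even_pow.2 ⟨even_two, by omega⟩)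
  have hle : 2 ≤ 2 ^ k := Nat.le_self_pow (by omega) 2
  simp_rw [abs_mul]
  rw [← Finset.mul_sum, sum_abs_walsh_mul heven hle D hD (by positivity),
    abs_of_nonneg (by positivity)]
  have hpos : (0 : ℝ) < 2 ^ k := by positivity
  push_cast
  rw [mul_pow, mul_pow, div_pow, div_pow, Real.sq_sqrt hpos.le, Real.sq_sqrt zero_le_two]
  field_simp
end

section
/- Fix d ≥ 2 and let Z be a standard Gaussian vector in ℝ^d. For every constant ε with 0 < ε < 1, E[d·‖Z‖₂²/‖Z‖₁²] ≤ (π/2)·(1+ε) + d·exp(−d·ε²/(16·(π−2))). -/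
open MeasureTheory BigOperators Real

theorem exp_neg_le_quadratic {x : ℝ} (hx : 0 ≤ x) : exp (-x) ≤ 1 - x + x ^ 2 / 2 := by
  have h := Real.quadratic_le_exp_of_nonneg hx
  have h1 : exp (-x) * exp x = 1 := by rw [← Real.exp_add]; simp
  have h2 : 0 < 1 - x + x ^ 2 / 2 := by nlinarith [sq_nonneg (x - 1)]
  have h3 : 1 ≤ (1 - x + x ^ 2 / 2) * exp x := by
    nlinarith [mul_le_mul_of_nonneg_left h h2.le, sq_nonneg (x ^ 2)]
  nlinarith [Real.exp_pos x]

theorem cubic_le_exp_neg {x : ℝ} (hx0 : 0 ≤ x) (hx1 : x ≤ 1) :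
    1 - x + x ^ 2 / 2 - 2 / 9 * x ^ 3 ≤ exp (-x) := by
  have h := Real.exp_bound (x := -x) (by rwa [abs_neg, abs_of_nonneg hx0]) (n := 3) (by norm_num)
  rw [abs_neg, abs_of_nonneg hx0] at h
  have h' := (abs_le.mp h).1
  norm_num [Finset.sum_range_succ, Nat.factorial] at h'
  linarith

theorem exp_mul_tilted_moment_le_exp_neg {ε : ℝ} (hε0 : 0 < ε) (hε1 : ε < 1) :
    exp ((ε / 4 * (1 + ε / 3)) ^ 2 / (2 * ((1 + ε / 8) ^ 2 - 1) * (1 + ε))) *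
        ((1 + ε / 8) * (1 - ε / 4 * (1 + ε / 3) + π / 4 * (ε / 4 * (1 + ε / 3)) ^ 2))
      ≤ exp (-(ε ^ 2 / (16 * (π - 2)))) := by
  have hπ0 := Real.pi_gt_d2
  have hπ1 := Real.pi_lt_d2
  set E := (ε / 4 * (1 + ε / 3)) ^ 2 / (2 * ((1 + ε / 8) ^ 2 - 1) * (1 + ε)) with hE
  set w := ε ^ 2 / (16 * (π - 2)) with hw
  have hden : 0 < 2 * ((1 + ε / 8) ^ 2 - 1) * (1 + ε) := by
    have : 0 < (1 + ε / 8) ^ 2 - 1 := by nlinarith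
    positivity
  have hE' : E ≤ ε / 8 - 163 / 8000 * ε ^ 2 := by
    rw [hE, div_le_iff₀ hden]
    have : (1 + ε / 3) ^ 2 ≤ (1 - 163 / 1000 * ε) * (1 + ε) * (1 + ε / 16) := by
      nlinarith [mul_pos hε0 (sub_pos.mpr hε1), mul_pos (mul_pos hε0 hε0) (sub_pos.mpr hε1)]
    nlinarith [mul_le_mul_of_nonneg_left this (sq_nonneg ε)]
  have hw' : w ≤ ε ^ 2 / (456 / 25) := by
    rw [hw]; gcongr; linarith
  set Q := ε / 8 + 69 / 2000 * ε ^ 2 with hQ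
  have hxQ : E + w ≤ Q := by nlinarith [sq_nonneg ε]
  have hQ0 : 0 ≤ Q := by positivity
  have hQ1 : Q ≤ 1 := by nlinarith
  have hcub := cubic_le_exp_neg hQ0 hQ1
  have hP : (1 + ε / 8) * (1 - ε / 4 * (1 + ε / 3) + π / 4 * (ε / 4 * (1 + ε / 3)) ^ 2)
      ≤ 1 - Q + Q ^ 2 / 2 - 2 / 9 * Q ^ 3 := by
    calc _ ≤ (1 + ε / 8) *
          (1 - ε / 4 * (1 + ε / 3) + 3.15 / 4 * (ε / 4 * (1 + ε / 3)) ^ 2) := by gcongr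
      _ ≤ _ := by
        rw [hQ]
        have hδ : 0 < 1 - ε := by linarith
        have h1 : 0 < ε ^ 2 := by positivity
        nlinarith [mul_pos h1 hδ, mul_pos (mul_pos h1 hε0) hδ, mul_pos h1 (pow_pos hδ 2),
          mul_pos (mul_pos h1 hε0) (pow_pos hδ 2), mul_pos h1 (pow_pos hδ 3),
          mul_pos (mul_pos h1 (pow_pos hε0 2)) (pow_pos hδ 2), mul_pos h1 (pow_pos hδ 4),
          mul_pos (mul_pos h1 (pow_pos hε0 3)) (pow_pos hδ 1), mul_pos h1 (pow_pos hε0 4),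
          mul_pos (mul_pos h1 (pow_pos hε0 1)) (pow_pos hδ 3)]
  calc _ ≤ exp E * exp (-Q) := by gcongr; exact hP.trans hcub
    _ = exp (E - Q) := by rw [← Real.exp_add]; ring_nf
    _ ≤ _ := by gcongr; linarith

theorem integrable_abs_pow_mul_exp_neg_mul_sq {b : ℝ} (hb : 0 < b) (n : ℕ) :
    Integrable fun x : ℝ => |x| ^ n * exp (-b * x ^ 2) := by
  have h := (integrable_rpow_mul_exp_neg_mul_sq hb (s := n)
    (by have : (0 : ℝ) ≤ n := n.cast_nonneg; linarith)).norm
  simpa [abs_mul, abs_pow] using h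

theorem integral_abs_pow_mul_exp_neg_mul_sq {b : ℝ} (hb : 0 < b) (n : ℕ) :
    ∫ x : ℝ, |x| ^ n * exp (-b * x ^ 2) =
      b ^ (-((n : ℝ) + 1) / 2) * Gamma (((n : ℝ) + 1) / 2) := by
  have h := integral_rpow_mul_exp_neg_mul_rpow (p := 2) (q := n) two_pos
    (by have : (0 : ℝ) ≤ n := n.cast_nonneg; linarith) hb
  have h' := integral_comp_abs (f := fun x : ℝ => x ^ n * exp (-b * x ^ 2))
  simp only [Real.rpow_natCast, Real.rpow_two] at h
  simp only [sq_abs] at h'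
  rw [h', h]
  ring

theorem integrable_and_integral_exp_mul_sq_mul_quadratic_abs_gaussianReal
    {r : ℝ} (hr : 0 < r) (a : ℝ) :
    Integrable (fun x => exp ((1 - (r ^ 2)⁻¹) / 2 * x ^ 2) *
        (1 - a * √(π / 2) * |x| + (a * √(π / 2) * |x|) ^ 2 / 2))
        (ProbabilityTheory.gaussianReal 0 1) ∧
      ∫ x, exp ((1 - (r ^ 2)⁻¹) / 2 * x ^ 2) *
        (1 - a * √(π / 2) * |x| + (a * √(π / 2) * |x|) ^ 2 / 2)
        ∂ProbabilityTheory.gaussianReal 0 1 =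
      r * (1 - a * r + π / 4 * (a * r) ^ 2) := by
  have hb : 0 < (2 * r ^ 2)⁻¹ := by positivity
  have hsq : √(π / 2) ^ 2 = π / 2 := Real.sq_sqrt (by positivity)
  have hfun : (fun x => ProbabilityTheory.gaussianPDFReal 0 1 x •
      (exp ((1 - (r ^ 2)⁻¹) / 2 * x ^ 2) *
        (1 - a * √(π / 2) * |x| + (a * √(π / 2) * |x|) ^ 2 / 2))) = fun x =>
      (√(2 * π))⁻¹ * (|x| ^ 0 * exp (-(2 * r ^ 2)⁻¹ * x ^ 2)) +
      (-(√(2 * π))⁻¹ * (a * √(π / 2))) * (|x| ^ 1 * exp (-(2 * r ^ 2)⁻¹ * x ^ 2)) +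
      ((√(2 * π))⁻¹ * (a ^ 2 * π / 4)) * (|x| ^ 2 * exp (-(2 * r ^ 2)⁻¹ * x ^ 2)) := by
    ext x
    have he : exp (-(2 * r ^ 2)⁻¹ * x ^ 2) =
        exp (-x ^ 2 / 2) * exp ((1 - (r ^ 2)⁻¹) / 2 * x ^ 2) := by
      rw [← Real.exp_add]
      congr 1
      field_simp
      ring
    simp only [ProbabilityTheory.gaussianPDFReal, he, mul_pow, hsq, smul_eq_mul, NNReal.coe_one,
      mul_one, sub_zero]
    ring
  have h0 := (integrable_abs_pow_mul_exp_neg_mul_sq hb 0).const_mul ((√(2 * π))⁻¹)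
  have h1 := (integrable_abs_pow_mul_exp_neg_mul_sq hb 1).const_mul
    (-(√(2 * π))⁻¹ * (a * √(π / 2)))
  have h2 := (integrable_abs_pow_mul_exp_neg_mul_sq hb 2).const_mul
    ((√(2 * π))⁻¹ * (a ^ 2 * π / 4))
  refine ⟨?_, ?_⟩
  · rw [ProbabilityTheory.gaussianReal_of_var_ne_zero 0 one_ne_zero,
      integrable_withDensity_iff_integrable_smul'
        (ProbabilityTheory.measurable_gaussianPDF _ _)
        (ae_of_all _ fun _ => ProbabilityTheory.gaussianPDF_lt_top)]
    simp only [ProbabilityTheory.toReal_gaussianPDF]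
    rw [hfun]
    exact (h0.fun_add h1).fun_add h2
  · rw [ProbabilityTheory.integral_gaussianReal_eq_integral_smul one_ne_zero, hfun,
      integral_add (h0.fun_add h1) h2, integral_add h0 h1]
    simp only [integral_const_mul, integral_abs_pow_mul_exp_neg_mul_sq hb]
    have g0 : Gamma (((0 : ℕ) + 1 : ℝ) / 2) = √π := by
      rw [← Real.Gamma_one_half_eq]; norm_num
    have g1 : Gamma (((1 : ℕ) + 1 : ℝ) / 2) = 1 := by norm_num
    have g2 : Gamma (((2 : ℕ) + 1 : ℝ) / 2) = √π / 2 := by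
      rw [show (((2 : ℕ) + 1 : ℝ) / 2) = 1 / 2 + 1 by norm_num,
        Real.Gamma_add_one (by norm_num), Real.Gamma_one_half_eq]
      ring
    have hpow (n : ℕ) : (2 * r ^ 2)⁻¹ ^ (-((n : ℝ) + 1) / 2) = (√2 * r) ^ (n + 1) := by
      have : (2 * r ^ 2)⁻¹ = (√2 * r) ^ (-2 : ℝ) := by
        rw [Real.rpow_neg (by positivity), Real.rpow_two, mul_pow, Real.sq_sqrt two_pos.le]
      rw [this, ← Real.rpow_mul (by positivity), ← Real.rpow_natCast]
      congr 1
      push_cast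
      ring
    rw [hpow, hpow, hpow, g0, g1, g2, Real.sqrt_mul two_pos.le, Real.sqrt_div pi_pos.le]
    have h2 : √2 ^ 2 = 2 := Real.sq_sqrt two_pos.le
    have hs2 : 0 < √2 := by positivity
    have hsπ : 0 < √π := by positivity
    field_simp
    ring_nf
    rw [show √2 ^ 4 = (√2 ^ 2) ^ 2 by ring, h2]
    ring

theorem mul_sum_sq_div_sq_sum_abs_le {d : ℕ} {ε a b : ℝ} (hε : 0 < 1 + ε) (hb : 0 < b)
    (ha : 0 ≤ a) (z : Fin d → ℝ) :
    (d : ℝ) * (∑ i, (z i) ^ 2) / (∑ i, |z i|) ^ 2 ≤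
      π / 2 * (1 + ε) + d * ∏ i, (exp (a ^ 2 / (2 * b * (1 + ε))) * (exp (b / 2 * z i ^ 2) *
        (1 - a * √(π / 2) * |z i| + (a * √(π / 2) * |z i|) ^ 2 / 2))) := by
  set T := ∑ i, |z i| with hT
  set S := ∑ i, (z i) ^ 2 with hS
  set q := √(π / 2) with hq
  have hq2 : q ^ 2 = π / 2 := Real.sq_sqrt (by positivity)
  have hq0 : 0 ≤ q := Real.sqrt_nonneg _
  have hST : S ≤ T ^ 2 := by
    have := Finset.sum_sq_le_sq_sum_of_nonneg (s := Finset.univ) (f := fun i => |z i|)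
      (fun _ _ => abs_nonneg _)
    simpa only [sq_abs] using this
  have hle : (∏ i, exp (a ^ 2 / (2 * b * (1 + ε)) + b / 2 * z i ^ 2 + -(a * q * |z i|))) ≤
      ∏ i, (exp (a ^ 2 / (2 * b * (1 + ε))) * (exp (b / 2 * z i ^ 2) *
        (1 - a * q * |z i| + (a * q * |z i|) ^ 2 / 2))) := by
    refine Finset.prod_le_prod (fun _ _ => (exp_pos _).le) fun i _ => ?_
    rw [Real.exp_add, Real.exp_add, mul_assoc]
    gcongr
    exact exp_neg_le_quadratic (by positivity)
  rw [← Real.exp_sum] at hle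
  have hsum : ∑ i, (a ^ 2 / (2 * b * (1 + ε)) + b / 2 * z i ^ 2 + -(a * q * |z i|)) =
      d * (a ^ 2 / (2 * b * (1 + ε))) + b / 2 * S - a * q * T := by
    simp only [Finset.sum_add_distrib, Finset.sum_neg_distrib, ← Finset.mul_sum, hS, hT]
    simp
    ring
  rw [hsum] at hle
  have hprod := (exp_pos _).le.trans hle
  rcases le_or_gt (d * S / T ^ 2) (π / 2 * (1 + ε)) with h | h
  · have : 0 ≤ (d : ℝ) * ∏ i, (exp (a ^ 2 / (2 * b * (1 + ε))) * (exp (b / 2 * z i ^ 2) *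
        (1 - a * q * |z i| + (a * q * |z i|) ^ 2 / 2))) := by positivity
    linarith
  · have hB : 0 < π / 2 * (1 + ε) := by positivity
    have hT2 : 0 < T ^ 2 := by
      rcases (sq_nonneg T).eq_or_lt with h0 | h0
      · rw [← h0, div_zero] at h
        linarith
      · exact h0
    have hd : 0 < (d : ℝ) := by
      rcases (Nat.cast_nonneg (α := ℝ) d).eq_or_lt with h0 | h0
      · rw [← h0, zero_mul, zero_div] at h
        linarith
      · exact h0
    rw [lt_div_iff₀ hT2, ← hq2] at h
    have hexp : 0 ≤ d * (a ^ 2 / (2 * b * (1 + ε))) + b / 2 * S - a * q * T := by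
      have hnum : 0 ≤ (d * a) ^ 2 + b ^ 2 * (1 + ε) * (d * S) - 2 * a * b * (1 + ε) * q * d * T := by
        nlinarith [sq_nonneg (b * (1 + ε) * q * T - d * a),
          mul_le_mul_of_nonneg_left h.le (show 0 ≤ b ^ 2 * (1 + ε) by positivity)]
      have heq : d * (a ^ 2 / (2 * b * (1 + ε))) + b / 2 * S - a * q * T =
          ((d * a) ^ 2 + b ^ 2 * (1 + ε) * (d * S) - 2 * a * b * (1 + ε) * q * d * T) /
            (2 * b * (1 + ε) * d) := by
        field_simp
      rw [heq]
      positivity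
    have h1 := (Real.one_le_exp hexp).trans hle
    calc d * S / T ^ 2 ≤ d * 1 := by
          rw [mul_div_assoc]
          gcongr
          exact div_le_one_of_le₀ hST hT2.le
      _ ≤ d * ∏ i, (exp (a ^ 2 / (2 * b * (1 + ε))) * (exp (b / 2 * z i ^ 2) *
        (1 - a * q * |z i| + (a * q * |z i|) ^ 2 / 2))) := by gcongr
      _ ≤ _ := by linarith

theorem unbiased_drive_bernstein_bound (d : ℕ) (hd : 2 ≤ d)
    (ε : ℝ) (hε0 : 0 < ε) (hε1 : ε < 1) :
    (∫ z, (d : ℝ) * (∑ i, (z i) ^ 2) / (∑ i, |z i|) ^ 2 ∂stdGaussian d)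
      ≤ (π / 2) * (1 + ε) + (d : ℝ) * Real.exp (-(d : ℝ) * ε ^ 2 / (16 * (π - 2))) := by
  set r := 1 + ε / 8 with hr
  set A := ε / 4 * (1 + ε / 3) with hA
  have hr0 : 0 < r := by positivity
  have hr1 : 0 < r ^ 2 - 1 := by rw [hr]; nlinarith
  have hA0 : 0 ≤ A := by positivity
  have hb : 0 < 1 - (r ^ 2)⁻¹ := by
    have : 1 - (r ^ 2)⁻¹ = (r ^ 2 - 1) / r ^ 2 := by field_simp
    rw [this]
    positivity
  have hE : (A / r) ^ 2 / (2 * (1 - (r ^ 2)⁻¹) * (1 + ε)) =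
      A ^ 2 / (2 * (r ^ 2 - 1) * (1 + ε)) := by
    have : 1 - (r ^ 2)⁻¹ = (r ^ 2 - 1) / r ^ 2 := by field_simp
    rw [this]
    field_simp
  obtain ⟨hint, hval⟩ := integrable_and_integral_exp_mul_sq_mul_quadratic_abs_gaussianReal
    hr0 (A / r)
  rw [div_mul_cancel₀ _ hr0.ne'] at hval
  set f : ℝ → ℝ := fun x => exp ((A / r) ^ 2 / (2 * (1 - (r ^ 2)⁻¹) * (1 + ε))) *
    (exp ((1 - (r ^ 2)⁻¹) / 2 * x ^ 2) *
      (1 - A / r * √(π / 2) * |x| + (A / r * √(π / 2) * |x|) ^ 2 / 2)) with hf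
  have hfint : Integrable f (ProbabilityTheory.gaussianReal 0 1) := hint.const_mul _
  have hprod : Integrable (fun z : Fin d → ℝ => ∏ i, f (z i)) (stdGaussian d) :=
    Integrable.fintype_prod (f := fun _ => f) fun _ => hfint
  have : IsProbabilityMeasure (stdGaussian d) := by unfold stdGaussian; infer_instance
  have hfval : ∫ x, f x ∂ProbabilityTheory.gaussianReal 0 1 ≤ exp (-(ε ^ 2 / (16 * (π - 2)))) := by
    rw [hf, integral_const_mul, hval, hE]
    exact exp_mul_tilted_moment_le_exp_neg hε0 hε1
  have hfnn : 0 ≤ ∫ x, f x ∂ProbabilityTheory.gaussianReal 0 1 :=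
    integral_nonneg fun x => mul_nonneg (exp_pos _).le <| mul_nonneg (exp_pos _).le <| by
      nlinarith [sq_nonneg (A / r * √(π / 2) * |x| - 1)]
  calc _ ≤ ∫ z, (π / 2 * (1 + ε) + d * ∏ i, f (z i)) ∂stdGaussian d := by
        refine integral_mono_of_nonneg (ae_of_all _ fun z => ?_)
          ((integrable_const _).add (hprod.const_mul _)) (ae_of_all _ fun z => ?_)
        · simp only [Pi.zero_apply]
          positivity
        · exact mul_sum_sq_div_sq_sum_abs_le (by linarith) hb (by positivity) z
    _ = π / 2 * (1 + ε) + d * (∫ x, f x ∂ProbabilityTheory.gaussianReal 0 1) ^ d := by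
        rw [integral_add (integrable_const _) (hprod.const_mul _)]
        simp only [stdGaussian, integral_const_mul, integral_fintype_prod_eq_pow f, integral_const,
          probReal_univ, one_smul, Fintype.card_fin]
    _ ≤ π / 2 * (1 + ε) + d * exp (-(ε ^ 2 / (16 * (π - 2)))) ^ d := by gcongr
    _ = _ := by
        rw [← Real.exp_nat_mul]
        ring_nf
end
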